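/- Let 0 < δ < 1 and β₀ ∈ (0,1]. There exists a constant C > 0, depending only on b, p, β₀, Γ and δ, such that for every g satisfying (G1)–(G4), every ε with 0 < ε < δ/4, every μ with δ < μ < ∞, and all ξ₀, ξ₁ ∈ ℝ^k with δ + μ/4 ≤ |ξ₀| ≤ δ + μ and |ξ₁| ≤ δ + μ, one has |ℬ_ε(ξ₀)(ξ₁ − ξ₀) − (A_ε(ξ₁) − A_ε(ξ₀))| ≤ C·μ^{p−2−β₀}·|ξ₁ − ξ₀|^{1+β₀}. -/

import Mathlib

open Real RealInnerProductSpace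

section GradientMap

variable {E : Type*} [NormedAddCommGroup E] [InnerProductSpace ℝ E]

/-- The first-order Taylor remainder at `ξ₀` of the radial field `ξ ↦ h (ε² + ‖ξ‖²) ξ`,
where `dh` stands for the derivative of `h`. -/
noncomputable def radialRemainder (h dh : ℝ → ℝ) (ε : ℝ) (ξ₀ ξ₁ : E) : E :=
  h (ε ^ 2 + ‖ξ₀‖ ^ 2) • (ξ₁ - ξ₀)
    + (2 * dh (ε ^ 2 + ‖ξ₀‖ ^ 2) * ⟪ξ₀, ξ₁ - ξ₀⟫) • ξ₀
    - (h (ε ^ 2 + ‖ξ₁‖ ^ 2) • ξ₁ - h (ε ^ 2 + ‖ξ₀‖ ^ 2) • ξ₀)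

lemma hasDerivAt_radial_line {h dh : ℝ → ℝ}
    (hd : ∀ σ, 0 < σ → HasDerivAt h (dh σ) σ) {ε : ℝ} (hε : 0 < ε) (ξ η : E) (t : ℝ) :
    HasDerivAt (fun t : ℝ => h (ε ^ 2 + ‖ξ + t • η‖ ^ 2) • (ξ + t • η))
      (h (ε ^ 2 + ‖ξ + t • η‖ ^ 2) • η
        + (2 * dh (ε ^ 2 + ‖ξ + t • η‖ ^ 2) * ⟪ξ + t • η, η⟫) • (ξ + t • η)) t := by
  have h1 : HasDerivAt (fun t : ℝ => ξ + t • η) η t := by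
    simpa using ((hasDerivAt_id t).smul_const η).const_add ξ
  have h2 : HasDerivAt (fun t : ℝ => ε ^ 2 + ‖ξ + t • η‖ ^ 2) (2 * ⟪ξ + t • η, η⟫) t :=
    h1.norm_sq.const_add _
  have h3 := (hd (ε ^ 2 + ‖ξ + t • η‖ ^ 2) (by positivity)).comp t h2
  refine (h3.smul h1).congr_deriv ?_
  simp only [Function.comp_apply]
  module

/-- Remainder bound in the regime where the segment stays away from the origin. -/
lemma norm_radialRemainder_le_of_near {h dh : ℝ → ℝ}
    (hd : ∀ σ, 0 < σ → HasDerivAt h (dh σ) σ) {ε P Q : ℝ} (hε : 0 < ε) {ξ₀ ξ₁ : E}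
    (hεm : ε ≤ ‖ξ₀‖ / 4) (hr : ‖ξ₁ - ξ₀‖ ≤ ‖ξ₀‖ / 4)
    (hP : ∀ σ ∈ Set.Icc (‖ξ₀‖ ^ 2 / 4) (7 * ‖ξ₀‖ ^ 2), |dh σ| ≤ P)
    (hQ : ∀ σ ∈ Set.Icc (‖ξ₀‖ ^ 2 / 4) (7 * ‖ξ₀‖ ^ 2),
      |σ - (ε ^ 2 + ‖ξ₀‖ ^ 2)| ≤ 9 / 4 * ‖ξ₀‖ * ‖ξ₁ - ξ₀‖ →
        |dh σ - dh (ε ^ 2 + ‖ξ₀‖ ^ 2)| ≤ Q) :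
    ‖radialRemainder h dh ε ξ₀ ξ₁‖ ≤
      27 / 4 * P * ‖ξ₀‖ * ‖ξ₁ - ξ₀‖ ^ 2 + 25 / 8 * Q * ‖ξ₀‖ ^ 2 * ‖ξ₁ - ξ₀‖ := by
  set η := ξ₁ - ξ₀ with hη
  have hξ₁ : ξ₁ = ξ₀ + η := by simp [hη]
  set m := ‖ξ₀‖ with hm
  set r := ‖η‖ with hrr
  have hr0 : 0 ≤ r := norm_nonneg _
  have hm0 : 0 < m := by linarith
  set s : ℝ → ℝ := fun t => ε ^ 2 + ‖ξ₀ + t • η‖ ^ 2 with hs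
  have hs0 : s 0 = ε ^ 2 + m ^ 2 := by simp [hs, hm]
  have hεsq : ε ^ 2 ≤ m ^ 2 / 16 := by nlinarith
  have hinner : |⟪ξ₀, η⟫| ≤ m * r := abs_real_inner_le_norm _ _
  have key : ∀ t ∈ Set.Icc (0 : ℝ) 1, ‖ξ₀ + t • η‖ ≤ 5 / 4 * m ∧ ‖t • η‖ ≤ r ∧
      s t ∈ Set.Icc (m ^ 2 / 4) (7 * m ^ 2) ∧ |s t - s 0| ≤ 9 / 4 * m * r := by
    rintro t ⟨ht0, ht1⟩
    have h1 : ‖t • η‖ ≤ r := by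
      rw [norm_smul, Real.norm_of_nonneg ht0]
      exact mul_le_of_le_one_left hr0 ht1
    have h2 : ‖ξ₀ + t • η‖ ≤ 5 / 4 * m := by
      have := norm_add_le ξ₀ (t • η)
      linarith
    have h3 : 3 / 4 * m ≤ ‖ξ₀ + t • η‖ := by
      have := norm_sub_le (ξ₀ + t • η) (t • η)
      rw [add_sub_cancel_right] at this
      linarith
    refine ⟨h2, h1, ⟨?_, ?_⟩, ?_⟩
    · simp only [hs]; nlinarith
    · simp only [hs]; nlinarith
    · have : s t - s 0 = 2 * (t * ⟪ξ₀, η⟫) + ‖t • η‖ ^ 2 := by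
        rw [hs0]; simp only [hs]
        rw [norm_add_sq_real, inner_smul_right]; ring
      rw [this]
      have h4 : |t * ⟪ξ₀, η⟫| ≤ m * r := by
        rw [abs_mul, abs_of_nonneg ht0]
        exact (mul_le_of_le_one_left (abs_nonneg _) ht1).trans hinner
      have h5 : ‖t • η‖ ^ 2 ≤ 1 / 4 * (m * r) := by nlinarith [norm_nonneg (t • η)]
      have h6 := abs_le.mp h4
      rw [abs_le]
      constructor <;> nlinarith [sq_nonneg ‖t • η‖]
  have h0mem : (0 : ℝ) ∈ Set.Icc (0 : ℝ) 1 := by simp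
  have hP0 : |dh (s 0)| ≤ P := hP _ (key 0 h0mem).2.2.1
  have hPnn : 0 ≤ P := (abs_nonneg _).trans hP0
  have hh : ∀ t ∈ Set.Icc (0 : ℝ) 1, |h (s t) - h (s 0)| ≤ P * (9 / 4 * m * r) := by
    intro t ht
    have := (convex_Icc (m ^ 2 / 4) (7 * m ^ 2)).norm_image_sub_le_of_norm_hasDerivWithin_le
      (f := h) (f' := dh) (C := P)
      (fun σ hσ => (hd σ (lt_of_lt_of_le (by positivity) hσ.1)).hasDerivWithinAt)
      (fun σ hσ => hP σ hσ) (key 0 h0mem).2.2.1 (key t ht).2.2.1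
    exact this.trans (mul_le_mul_of_nonneg_left (key t ht).2.2.2 hPnn)
  set φ : ℝ → E := fun t => h (s t) • (ξ₀ + t • η) with hφ
  set φ' : ℝ → E := fun t => h (s t) • η + (2 * dh (s t) * ⟪ξ₀ + t • η, η⟫) • (ξ₀ + t • η)
    with hφ'
  have hder : ∀ t, HasDerivAt (fun t => φ t - t • φ' 0) (φ' t - φ' 0) t := by
    intro t
    have h1 : HasDerivAt (fun t : ℝ => t • φ' 0) (φ' 0) t := by
      simpa using (hasDerivAt_id t).smul_const (φ' 0)
    exact (hasDerivAt_radial_line hd hε ξ₀ η t).sub h1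
  have hbound : ∀ t ∈ Set.Ico (0 : ℝ) 1, ‖φ' t - φ' 0‖ ≤
      27 / 4 * P * m * r ^ 2 + 25 / 8 * Q * m ^ 2 * r := by
    intro t ht
    have ht' : t ∈ Set.Icc (0 : ℝ) 1 := ⟨ht.1, ht.2.le⟩
    obtain ⟨k1, k2, k3, k4⟩ := key t ht'
    have hQt : |dh (s t) - dh (s 0)| ≤ Q := by
      have := hQ (s t) k3 (by rw [← hs0]; exact k4)
      rwa [← hs0] at this
    have hQnn : 0 ≤ Q := (abs_nonneg _).trans hQt
    have hdecomp : φ' t - φ' 0 = (h (s t) - h (s 0)) • η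
        + (2 * (dh (s t) - dh (s 0)) * ⟪ξ₀ + t • η, η⟫) • (ξ₀ + t • η)
        + ((2 * dh (s 0) * ⟪t • η, η⟫) • (ξ₀ + t • η)
          + (2 * dh (s 0) * ⟪ξ₀, η⟫) • (t • η)) := by
      simp only [hφ', zero_smul, add_zero, inner_add_left, inner_zero_left]
      module
    rw [hdecomp]
    have e1 : ‖(h (s t) - h (s 0)) • η‖ ≤ P * (9 / 4 * m * r) * r := by
      rw [norm_smul]
      exact mul_le_mul_of_nonneg_right (hh t ht') hr0
    have i1 : |⟪ξ₀ + t • η, η⟫| ≤ 5 / 4 * m * r :=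
      (abs_real_inner_le_norm _ _).trans (mul_le_mul_of_nonneg_right k1 hr0)
    have i2 : |⟪t • η, η⟫| ≤ r * r :=
      (abs_real_inner_le_norm _ _).trans (mul_le_mul_of_nonneg_right k2 hr0)
    have e2 : ‖(2 * (dh (s t) - dh (s 0)) * ⟪ξ₀ + t • η, η⟫) • (ξ₀ + t • η)‖ ≤
        2 * Q * (5 / 4 * m * r) * (5 / 4 * m) := by
      rw [norm_smul, Real.norm_eq_abs, abs_mul, abs_mul, abs_two]
      gcongr
    have e3 : ‖(2 * dh (s 0) * ⟪t • η, η⟫) • (ξ₀ + t • η)‖ ≤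
        2 * P * (r * r) * (5 / 4 * m) := by
      rw [norm_smul, Real.norm_eq_abs, abs_mul, abs_mul, abs_two]
      gcongr
    have e4 : ‖(2 * dh (s 0) * ⟪ξ₀, η⟫) • (t • η)‖ ≤ 2 * P * (m * r) * r := by
      rw [norm_smul, Real.norm_eq_abs, abs_mul, abs_mul, abs_two]
      gcongr
    refine (norm_add₃_le).trans ?_
    have := norm_add_le ((2 * dh (s 0) * ⟪t • η, η⟫) • (ξ₀ + t • η))
      ((2 * dh (s 0) * ⟪ξ₀, η⟫) • (t • η))
    linarith
  have hfin := norm_image_sub_le_of_norm_deriv_le_segment_01'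
    (f := fun t => φ t - t • φ' 0) (fun t _ => (hder t).hasDerivWithinAt) hbound
  have heq : radialRemainder h dh ε ξ₀ ξ₁
      = -((φ 1 - (1 : ℝ) • φ' 0) - (φ 0 - (0 : ℝ) • φ' 0)) := by
    simp only [radialRemainder, hφ, hφ', hs, ← hη, one_smul, zero_smul, add_zero, ← hξ₁]
    abel
  rw [heq, norm_neg]
  exact hfin

/-- Remainder bound without any smallness of `ξ₁ - ξ₀`, from size bounds alone. -/
lemma norm_radialRemainder_le_of_far (h dh : ℝ → ℝ) {ε N : ℝ} {ξ₀ ξ₁ : E} (hξ₀ : 0 < ‖ξ₀‖)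
    (hr : ‖ξ₀‖ / 4 ≤ ‖ξ₁ - ξ₀‖)
    (h0 : |h (ε ^ 2 + ‖ξ₀‖ ^ 2)| * ‖ξ₀‖ ≤ N)
    (h1 : |h (ε ^ 2 + ‖ξ₁‖ ^ 2)| * ‖ξ₁‖ ≤ N)
    (hd0 : |dh (ε ^ 2 + ‖ξ₀‖ ^ 2)| * ‖ξ₀‖ ^ 3 ≤ N) :
    ‖radialRemainder h dh ε ξ₀ ξ₁‖ ≤ 11 * N * (‖ξ₁ - ξ₀‖ / ‖ξ₀‖) := by
  set m := ‖ξ₀‖ with hm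
  set r := ‖ξ₁ - ξ₀‖ with hrr
  have hr0 : 0 ≤ r := norm_nonneg _
  obtain ⟨x, hx⟩ : ∃ x, x = r / m := ⟨_, rfl⟩
  have hrx : r = x * m := by rw [hx]; field_simp
  have hx4 : 1 / 4 ≤ x := by rw [hx, le_div_iff₀ hξ₀]; linarith
  have hN : 0 ≤ N := (mul_nonneg (abs_nonneg _) hξ₀.le).trans h0
  rw [← hx]
  have e1 : ‖h (ε ^ 2 + m ^ 2) • (ξ₁ - ξ₀)‖ ≤ N * x := by
    rw [norm_smul, Real.norm_eq_abs, ← hrr, hrx]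
    nlinarith
  have e2 : ‖(2 * dh (ε ^ 2 + m ^ 2) * ⟪ξ₀, ξ₁ - ξ₀⟫) • ξ₀‖ ≤ 2 * N * x := by
    rw [norm_smul, Real.norm_eq_abs, abs_mul, abs_mul, abs_two]
    calc 2 * |dh (ε ^ 2 + m ^ 2)| * |⟪ξ₀, ξ₁ - ξ₀⟫| * ‖ξ₀‖
        ≤ 2 * |dh (ε ^ 2 + m ^ 2)| * (m * r) * m := by
          gcongr
          exact abs_real_inner_le_norm _ _
      _ = 2 * (|dh (ε ^ 2 + m ^ 2)| * m ^ 3) * x := by rw [hrx]; ring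
      _ ≤ 2 * N * x := by gcongr
  have e3 : ‖h (ε ^ 2 + ‖ξ₁‖ ^ 2) • ξ₁‖ ≤ N := by rwa [norm_smul]
  have e4 : ‖h (ε ^ 2 + m ^ 2) • ξ₀‖ ≤ N := by rwa [norm_smul]
  have t1 := norm_sub_le (h (ε ^ 2 + m ^ 2) • (ξ₁ - ξ₀)
    + (2 * dh (ε ^ 2 + m ^ 2) * ⟪ξ₀, ξ₁ - ξ₀⟫) • ξ₀)
    (h (ε ^ 2 + ‖ξ₁‖ ^ 2) • ξ₁ - h (ε ^ 2 + m ^ 2) • ξ₀)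
  have t2 := norm_add_le (h (ε ^ 2 + m ^ 2) • (ξ₁ - ξ₀))
    ((2 * dh (ε ^ 2 + m ^ 2) * ⟪ξ₀, ξ₁ - ξ₀⟫) • ξ₀)
  have t3 := norm_sub_le (h (ε ^ 2 + ‖ξ₁‖ ^ 2) • ξ₁) (h (ε ^ 2 + m ^ 2) • ξ₀)
  unfold radialRemainder
  rw [← hm]
  nlinarith

lemma rpow_sub_one_half_mul_sqrt {σ q : ℝ} (hσ : 0 < σ) :
    σ ^ (q / 2 - 1) * √σ = σ ^ ((q - 1) / 2) := by
  rw [Real.sqrt_eq_rpow, ← Real.rpow_add hσ]; congr 1; ring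

lemma rpow_sub_two_mul_sqrt_cube {σ q : ℝ} (hσ : 0 < σ) :
    σ ^ (q / 2 - 2) * √σ ^ 3 = σ ^ ((q - 1) / 2) := by
  have : √σ ^ 3 = σ * √σ := by rw [pow_succ, Real.sq_sqrt hσ.le]
  rw [this, ← mul_assoc, ← Real.rpow_add_one hσ.ne', ← rpow_sub_one_half_mul_sqrt hσ]
  ring_nf

lemma rpow_half_le {σ m q : ℝ} (hσ : 0 ≤ σ) (hm : 0 < m) (hq : 1 ≤ q) (hσm : σ ≤ 65 * m ^ 2) :
    σ ^ ((q - 1) / 2) ≤ 65 ^ ((q - 1) / 2) * m ^ (q - 1) := by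
  calc σ ^ ((q - 1) / 2) ≤ (65 * m ^ 2) ^ ((q - 1) / 2) :=
        Real.rpow_le_rpow hσ hσm (by linarith)
    _ = 65 ^ ((q - 1) / 2) * m ^ (q - 1) := by
        rw [Real.mul_rpow (by norm_num) (by positivity), ← Real.rpow_natCast m 2,
          ← Real.rpow_mul hm.le]
        congr 2; push_cast; ring

/-- Hölder-type remainder bound for a radial field with `q`-growth, at the scale `‖ξ₀‖`. -/
lemma norm_radialRemainder_le {h dh : ℝ → ℝ} {q β K : ℝ} (hq : 1 ≤ q) (hβ : 0 < β)
    (hβ1 : β ≤ 1) (hd : ∀ σ, 0 < σ → HasDerivAt h (dh σ) σ)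
    (hh : ∀ σ, 0 < σ → |h σ| ≤ K * σ ^ (q / 2 - 1))
    (hdh : ∀ σ, 0 < σ → |dh σ| ≤ K * σ ^ (q / 2 - 2))
    (hH : ∀ μ : ℝ, 0 < μ → ∀ σ₁ ∈ Set.Icc (μ ^ 2 / 4) (7 * μ ^ 2),
      ∀ σ₂ ∈ Set.Icc (μ ^ 2 / 4) (7 * μ ^ 2),
      |dh σ₁ - dh σ₂| ≤ K * μ ^ (q - 4 - 2 * β) * |σ₁ - σ₂| ^ β)
    {ε : ℝ} (hε : 0 < ε) {ξ₀ ξ₁ : E} (hεm : ε ≤ ‖ξ₀‖ / 4) (hξ₁ : ‖ξ₁‖ ≤ 8 * ‖ξ₀‖) :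
    ‖radialRemainder h dh ε ξ₀ ξ₁‖ ≤
      62 * K * 65 ^ ((q - 1) / 2) * ‖ξ₀‖ ^ (q - 2 - β) * ‖ξ₁ - ξ₀‖ ^ (1 + β) := by
  obtain ⟨m, hm⟩ : ∃ m, m = ‖ξ₀‖ := ⟨_, rfl⟩
  obtain ⟨r, hr⟩ : ∃ r, r = ‖ξ₁ - ξ₀‖ := ⟨_, rfl⟩
  obtain ⟨L, hL⟩ : ∃ L : ℝ, L = 65 ^ ((q - 1) / 2) := ⟨_, rfl⟩
  have hm0 : 0 < m := by rw [hm]; linarith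
  have hr0 : 0 ≤ r := hr ▸ norm_nonneg _
  have hL1 : 1 ≤ L := hL ▸ Real.one_le_rpow (by norm_num) (by linarith)
  have hK : 0 ≤ K := by
    have := hh 1 one_pos
    rw [Real.one_rpow, mul_one] at this
    exact (abs_nonneg _).trans this
  obtain ⟨x, hx⟩ : ∃ x, x = r / m := ⟨_, rfl⟩
  have hrx : r = x * m := by rw [hx]; field_simp
  have hx0 : 0 ≤ x := hx ▸ div_nonneg hr0 hm0.le
  obtain ⟨M, hM⟩ : ∃ M, M = m ^ (q - 1) := ⟨_, rfl⟩
  have hM0 : 0 < M := hM ▸ Real.rpow_pos_of_pos hm0 _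
  have hX0 : 0 ≤ x ^ β := Real.rpow_nonneg hx0 _
  have hεsq : ε ^ 2 ≤ m ^ 2 / 16 := by rw [← hm] at hεm; nlinarith
  have hscale : m ^ (q - 2 - β) * r ^ (1 + β) = M * x * x ^ β := by
    rw [hrx, Real.mul_rpow hx0 hm0.le, Real.rpow_add' hx0 (by linarith), Real.rpow_one, hM,
      show q - 1 = (q - 2 - β) + (1 + β) by ring, Real.rpow_add hm0 (q - 2 - β)]
    ring
  have hgrow : ∀ σ, 0 < σ → σ ≤ 65 * m ^ 2 →
      |h σ| * √σ ≤ K * (L * M) ∧ |dh σ| * √σ ^ 3 ≤ K * (L * M) := by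
    intro σ h0 h1
    have hle : K * σ ^ ((q - 1) / 2) ≤ K * (L * M) := by
      rw [hL, hM]
      exact mul_le_mul_of_nonneg_left (rpow_half_le h0.le hm0 hq h1) hK
    constructor
    · refine le_trans ?_ hle
      rw [← rpow_sub_one_half_mul_sqrt h0, ← mul_assoc]
      exact mul_le_mul_of_nonneg_right (hh σ h0) (by positivity)
    · refine le_trans ?_ hle
      rw [← rpow_sub_two_mul_sqrt_cube h0, ← mul_assoc]
      exact mul_le_mul_of_nonneg_right (hdh σ h0) (by positivity)
  rw [mul_assoc _ (‖ξ₀‖ ^ _), ← hm, ← hr, hscale, ← hL]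
  rcases le_total r (m / 4) with hcase | hcase
  · have hx4 : x ≤ 1 / 4 := by rw [hx, div_le_iff₀ hm0]; linarith
    have hxX : x ≤ x ^ β := by
      simpa using Real.rpow_le_rpow_of_exponent_ge' hx0 (by linarith) hβ.le hβ1
    have hnear := norm_radialRemainder_le_of_near hd hε hεm
      (P := 8 * (K * (L * M)) / m ^ 3) (Q := 9 / 4 * K * (M / m ^ 3) * x ^ β)
      (by rw [← hr, ← hm]; exact hcase)
      (by
        rw [← hm]
        rintro σ ⟨hσ1, hσ2⟩
        have hσ0 : 0 < σ := lt_of_lt_of_le (by positivity) hσ1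
        have hsq : m / 2 ≤ √σ := Real.le_sqrt_of_sq_le (by linarith [div_pow m 2 2])
        rw [le_div_iff₀ (by positivity)]
        have h1 := (hgrow σ hσ0 (by nlinarith)).2
        have h2 : (m / 2) ^ 3 ≤ √σ ^ 3 := by gcongr
        have h3 := mul_le_mul_of_nonneg_left h2 (abs_nonneg (dh σ))
        linarith [div_pow m 2 3])
      (by
        rw [← hm, ← hr]
        intro σ hσ hdist
        refine (hH m hm0 σ hσ _ ⟨by nlinarith, by nlinarith⟩).trans ?_
        have h1 : |σ - (ε ^ 2 + m ^ 2)| ^ β ≤ 9 / 4 * m ^ (2 * β) * x ^ β := by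
          calc |σ - (ε ^ 2 + m ^ 2)| ^ β ≤ (9 / 4 * m * r) ^ β :=
                Real.rpow_le_rpow (abs_nonneg _) hdist hβ.le
            _ = (9 / 4) ^ β * m ^ (2 * β) * x ^ β := by
                rw [show 9 / 4 * m * r = 9 / 4 * m ^ 2 * x by rw [hrx]; ring,
                  Real.mul_rpow (by positivity) hx0, Real.mul_rpow (by norm_num) (by positivity),
                  ← Real.rpow_natCast m 2, ← Real.rpow_mul hm0.le]
                norm_num
            _ ≤ 9 / 4 * m ^ (2 * β) * x ^ β := by
                gcongr
                simpa using Real.rpow_le_rpow_of_exponent_le (by norm_num : (1 : ℝ) ≤ 9 / 4) hβ1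
        have h2 : m ^ (q - 4 - 2 * β) * m ^ (2 * β) = M / m ^ 3 := by
          rw [hM, ← Real.rpow_add hm0, ← Real.rpow_natCast m 3, ← Real.rpow_sub hm0]
          congr 1; push_cast; ring
        calc K * m ^ (q - 4 - 2 * β) * |σ - (ε ^ 2 + m ^ 2)| ^ β
            ≤ K * m ^ (q - 4 - 2 * β) * (9 / 4 * m ^ (2 * β) * x ^ β) := by gcongr
          _ = 9 / 4 * K * (m ^ (q - 4 - 2 * β) * m ^ (2 * β)) * x ^ β := by ring
          _ = 9 / 4 * K * (M / m ^ 3) * x ^ β := by rw [h2])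
    refine hnear.trans ?_
    rw [← hm, ← hr, hrx]
    have : 27 / 4 * (8 * (K * (L * M)) / m ^ 3) * m * (x * m) ^ 2
        + 25 / 8 * (9 / 4 * K * (M / m ^ 3) * x ^ β) * m ^ 2 * (x * m)
        = K * M * x * (54 * L * x + 225 / 32 * x ^ β) := by
      field_simp; ring
    rw [this]
    calc K * M * x * (54 * L * x + 225 / 32 * x ^ β)
        ≤ K * M * x * (62 * L * x ^ β) := by
          gcongr
          nlinarith [mul_le_mul_of_nonneg_left hxX (by linarith : 0 ≤ L),
            mul_le_mul_of_nonneg_right hL1 hX0]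
      _ = 62 * K * L * (M * x * x ^ β) := by ring
  · have hx4 : 1 / 4 ≤ x := by rw [hx, le_div_iff₀ hm0]; linarith
    have hX4 : 1 / 4 ≤ x ^ β := by
      calc (1 / 4 : ℝ) ≤ (1 / 4) ^ β := by
            simpa using Real.rpow_le_rpow_of_exponent_ge (by norm_num : (0 : ℝ) < 1 / 4)
              (by norm_num) hβ1
        _ ≤ x ^ β := Real.rpow_le_rpow (by norm_num) hx4 hβ.le
    have hsqrt : ∀ ξ : E, ‖ξ‖ ≤ √(ε ^ 2 + ‖ξ‖ ^ 2) := fun ξ =>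
      Real.le_sqrt_of_sq_le (by nlinarith)
    have hξ₁' : ‖ξ₁‖ ^ 2 ≤ 64 * m ^ 2 := by
      rw [← hm] at hξ₁; nlinarith [norm_nonneg ξ₁]
    have g0 := hgrow (ε ^ 2 + ‖ξ₀‖ ^ 2) (by positivity) (by rw [← hm]; nlinarith)
    have g1 := hgrow (ε ^ 2 + ‖ξ₁‖ ^ 2) (by positivity) (by nlinarith)
    have hfar := norm_radialRemainder_le_of_far h dh (ε := ε) (N := K * (L * M))
      (ξ₀ := ξ₀) (ξ₁ := ξ₁) (hm ▸ hm0) (by rw [← hm, ← hr]; exact hcase)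
      ((mul_le_mul_of_nonneg_left (hsqrt ξ₀) (abs_nonneg _)).trans g0.1)
      ((mul_le_mul_of_nonneg_left (hsqrt ξ₁) (abs_nonneg _)).trans g1.1)
      ((mul_le_mul_of_nonneg_left (pow_le_pow_left₀ (norm_nonneg _) (hsqrt ξ₀) 3)
        (abs_nonneg _)).trans g0.2)
    refine hfar.trans ?_
    rw [← hm, ← hr, ← hx]
    calc 11 * (K * (L * M)) * x = 44 * K * L * M * x * (1 / 4) := by ring
      _ ≤ 62 * K * L * M * x * x ^ β := by gcongr; norm_num
      _ = 62 * K * L * (M * x * x ^ β) := by ring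

end GradientMap

/-- The derivative of `σ ↦ b σ^{-1/2}` is Hölder continuous on dyadic-type intervals,
with the scaling of the exponent `q = 1`. -/
lemma abs_rpow_neg_three_half_sub_le {b β μ σ₁ σ₂ : ℝ} (hb : 0 < b) (hβ : 0 < β) (hβ1 : β ≤ 1)
    (hμ : 0 < μ) (h₁ : σ₁ ∈ Set.Icc (μ ^ 2 / 4) (7 * μ ^ 2))
    (h₂ : σ₂ ∈ Set.Icc (μ ^ 2 / 4) (7 * μ ^ 2)) :
    |(-(b / 2) * σ₁ ^ (-(3 / 2) : ℝ)) - (-(b / 2) * σ₂ ^ (-(3 / 2) : ℝ))| ≤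
      168 * b * μ ^ ((1 : ℝ) - 4 - 2 * β) * |σ₁ - σ₂| ^ β := by
  have hpos : ∀ σ ∈ Set.Icc (μ ^ 2 / 4) (7 * μ ^ 2), 0 < σ := fun σ hσ =>
    lt_of_lt_of_le (by positivity) hσ.1
  have hmv := (convex_Icc (μ ^ 2 / 4) (7 * μ ^ 2)).norm_image_sub_le_of_norm_hasDerivWithin_le
    (f := fun σ : ℝ => -(b / 2) * σ ^ (-(3 / 2) : ℝ))
    (f' := fun σ : ℝ => -(b / 2) * (-(3 / 2) * σ ^ (-(3 / 2) - 1 : ℝ)))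
    (C := 24 * b * μ ^ (-5 : ℝ))
    (fun σ hσ => ((Real.hasDerivAt_rpow_const (Or.inl (hpos σ hσ).ne')).const_mul
      _).hasDerivWithinAt)
    (fun σ hσ => by
      have h0 := hpos σ hσ
      have hnn : 0 ≤ -(b / 2) * (-(3 / 2) * σ ^ (-(3 / 2) - 1 : ℝ)) := by
        have := Real.rpow_nonneg h0.le (-(3 / 2) - 1 : ℝ)
        nlinarith
      rw [Real.norm_eq_abs, abs_of_nonneg hnn]
      have h1 : σ ^ (-(3 / 2) - 1 : ℝ) ≤ (μ ^ 2 / 4) ^ (-(3 / 2) - 1 : ℝ) :=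
        Real.rpow_le_rpow_of_nonpos (by positivity) hσ.1 (by norm_num)
      have h2 : (μ ^ 2 / 4) ^ (-(3 / 2) - 1 : ℝ) = 32 * μ ^ (-5 : ℝ) := by
        rw [show μ ^ 2 / 4 = (μ / 2) ^ (2 : ℝ) by rw [Real.rpow_two]; ring,
          ← Real.rpow_mul (by positivity), Real.div_rpow hμ.le (by norm_num)]
        norm_num [Real.rpow_neg]
        ring
      rw [h2] at h1
      nlinarith)
    h₂ h₁
  rw [Real.norm_eq_abs, Real.norm_eq_abs] at hmv
  refine hmv.trans ?_
  obtain ⟨d, hd⟩ : ∃ d, d = |σ₁ - σ₂| := ⟨_, rfl⟩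
  have hd0 : 0 ≤ d := hd ▸ abs_nonneg _
  have hd7 : d ≤ 7 * μ ^ 2 := by
    rw [hd, abs_le]; constructor <;> nlinarith [h₁.1, h₁.2, h₂.1, h₂.2]
  rw [← hd]
  have hsplit : d = d ^ (1 - β) * d ^ β := by
    rw [← Real.rpow_add' hd0 (by norm_num)]; simp
  have hle : d ^ (1 - β) ≤ 7 * μ ^ (2 - 2 * β) := by
    calc d ^ (1 - β) ≤ (7 * μ ^ 2) ^ (1 - β) := Real.rpow_le_rpow hd0 hd7 (by linarith)
      _ = 7 ^ (1 - β) * μ ^ (2 - 2 * β) := by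
          rw [Real.mul_rpow (by norm_num) (by positivity), ← Real.rpow_natCast μ 2,
            ← Real.rpow_mul hμ.le]
          congr 2; push_cast; ring
      _ ≤ 7 * μ ^ (2 - 2 * β) := by
          gcongr
          simpa using Real.rpow_le_rpow_of_exponent_le (by norm_num : (1 : ℝ) ≤ 7)
            (by linarith : 1 - β ≤ 1)
  have hμe : μ ^ (-5 : ℝ) * μ ^ (2 - 2 * β) = μ ^ ((1 : ℝ) - 4 - 2 * β) := by
    rw [← Real.rpow_add hμ]; congr 1; ring
  calc 24 * b * μ ^ (-5 : ℝ) * d = 24 * b * μ ^ (-5 : ℝ) * (d ^ (1 - β) * d ^ β) := by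
        rw [← hsplit]
    _ ≤ 24 * b * μ ^ (-5 : ℝ) * (7 * μ ^ (2 - 2 * β) * d ^ β) := by gcongr
    _ = 168 * b * (μ ^ (-5 : ℝ) * μ ^ (2 - 2 * β)) * d ^ β := by ring
    _ = _ := by rw [hμe]

lemma rpow_le_four_rpow_abs_mul {m μ a : ℝ} (hμ : 0 < μ) (h1 : μ / 4 ≤ m) (h2 : m ≤ 4 * μ) :
    m ^ a ≤ 4 ^ |a| * μ ^ a := by
  have hm : 0 < m := by linarith
  rcases le_total 0 a with ha | ha
  · rw [abs_of_nonneg ha, ← Real.mul_rpow (by norm_num) hμ.le]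
    exact Real.rpow_le_rpow hm.le h2 ha
  · rw [abs_of_nonpos ha, Real.rpow_neg (by norm_num), ← Real.inv_rpow (by norm_num),
      ← Real.mul_rpow (by norm_num) hμ.le]
    exact Real.rpow_le_rpow_of_nonpos (by positivity) (by linarith) ha

/-- Hessian error estimate: there exists `C > 0`, depending only on `b, p, β₀, Γ, δ`,
such that for every `g` satisfying (G1)–(G4), every `0 < ε < δ/4`, every `μ > δ`, and all
`ξ₀, ξ₁` with `δ + μ/4 ≤ |ξ₀| ≤ δ + μ`, `|ξ₁| ≤ δ + μ`, one has
`|ℬ_ε(ξ₀)(ξ₁ − ξ₀) − (A_ε(ξ₁) − A_ε(ξ₀))| ≤ C μ^{p−2−β₀} |ξ₁ − ξ₀|^{1+β₀}`. -/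
theorem stmt_4 (k : ℕ) (hk : 1 ≤ k) (p b β₀ Γ δ : ℝ)
    (hp : 1 < p) (hb : 0 < b) (hβ₀ : 0 < β₀) (hβ₀' : β₀ ≤ 1) (hΓ : 0 < Γ)
    (hδ0 : 0 < δ) (hδ1 : δ < 1) :
    ∃ C : ℝ, 0 < C ∧
      ∀ γ : ℝ, 0 < γ → γ ≤ Γ →
      ∀ g g' g'' : ℝ → ℝ,
        (∀ σ : ℝ, 0 < σ → HasDerivAt g (g' σ) σ) →
        (∀ σ : ℝ, 0 < σ → HasDerivAt g' (g'' σ) σ) →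
        ContinuousOn g'' (Set.Ioi 0) →
        (∀ σ : ℝ, 0 < σ → |g' σ| ≤ Γ * σ ^ (p / 2 - 1)) →
        (∀ σ : ℝ, 0 < σ → |g'' σ| ≤ Γ * σ ^ (p / 2 - 2)) →
        (∀ σ : ℝ, 0 ≤ σ → ∀ τ : ℝ, 0 < τ → τ < 1 →
          γ * (σ + τ) ^ (p / 2 - 1) ≤ g' (σ + τ) + 2 * σ * min (g'' (σ + τ)) 0) →
        (∀ μ : ℝ, 0 < μ → ∀ σ₁ ∈ Set.Icc (μ ^ 2 / 4) (7 * μ ^ 2),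
          ∀ σ₂ ∈ Set.Icc (μ ^ 2 / 4) (7 * μ ^ 2),
          |g'' σ₁ - g'' σ₂| ≤ Γ * μ ^ (p - 4 - 2 * β₀) * |σ₁ - σ₂| ^ β₀) →
        ∀ ε : ℝ, 0 < ε → ε < δ / 4 →
        ∀ μ : ℝ, δ < μ →
        ∀ ξ₀ ξ₁ : EuclideanSpace ℝ (Fin k),
          δ + μ / 4 ≤ ‖ξ₀‖ → ‖ξ₀‖ ≤ δ + μ → ‖ξ₁‖ ≤ δ + μ →
          ‖((b / Real.sqrt (ε ^ 2 + ‖ξ₀‖ ^ 2)) • (ξ₁ - ξ₀)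
              - (b * ⟪ξ₀, ξ₁ - ξ₀⟫ / (ε ^ 2 + ‖ξ₀‖ ^ 2) ^ ((3 : ℝ) / 2)) • ξ₀
              + g' (ε ^ 2 + ‖ξ₀‖ ^ 2) • (ξ₁ - ξ₀)
              + (2 * g'' (ε ^ 2 + ‖ξ₀‖ ^ 2) * ⟪ξ₀, ξ₁ - ξ₀⟫) • ξ₀)
            - (((b / Real.sqrt (ε ^ 2 + ‖ξ₁‖ ^ 2)) • ξ₁ + g' (ε ^ 2 + ‖ξ₁‖ ^ 2) • ξ₁)
              - ((b / Real.sqrt (ε ^ 2 + ‖ξ₀‖ ^ 2)) • ξ₀ + g' (ε ^ 2 + ‖ξ₀‖ ^ 2) • ξ₀))‖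
            ≤ C * μ ^ (p - 2 - β₀) * ‖ξ₁ - ξ₀‖ ^ (1 + β₀) := by
  set c : ℝ := 4 ^ |p - 2 - β₀|
  have hc0 : 0 < c := by positivity
  refine ⟨(62 * (168 * b) * δ ^ (1 - p) + 62 * Γ * 65 ^ ((p - 1) / 2)) * c, by positivity, ?_⟩
  intro γ _ _ g g' g'' _ hg' _ hG1 hG2 _ hG4 ε hε hεδ μ hμ ξ₀ ξ₁ hξ₀l hξ₀u hξ₁
  have hμ0 : 0 < μ := hδ0.trans hμ
  have hm : 0 < ‖ξ₀‖ := by linarith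
  have hεm : ε ≤ ‖ξ₀‖ / 4 := by linarith
  have hξ₁m : ‖ξ₁‖ ≤ 8 * ‖ξ₀‖ := by linarith
  have hgpart := norm_radialRemainder_le hp.le hβ₀ hβ₀' hg' hG1 hG2 hG4 hε hεm hξ₁m
  have hbpart := norm_radialRemainder_le (q := 1) (K := 168 * b)
    (h := fun σ => b * σ ^ (-(1 / 2) : ℝ)) (dh := fun σ => -(b / 2) * σ ^ (-(3 / 2) : ℝ))
    le_rfl hβ₀ hβ₀'
    (fun σ hσ => by
      refine ((Real.hasDerivAt_rpow_const (p := -(1 / 2))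
        (Or.inl hσ.ne')).const_mul b).congr_deriv ?_
      ring_nf)
    (fun σ hσ => by
      have := Real.rpow_pos_of_pos hσ (-(1 / 2))
      rw [abs_of_nonneg (by positivity)]
      norm_num at this ⊢
      nlinarith)
    (fun σ hσ => by
      have := Real.rpow_pos_of_pos hσ (-(3 / 2))
      rw [neg_mul, abs_neg, abs_of_nonneg (by positivity)]
      norm_num at this ⊢
      nlinarith)
    (fun μ hμ σ₁ h₁ σ₂ h₂ => abs_rpow_neg_three_half_sub_le hb hβ₀ hβ₀' hμ h₁ h₂)
    hε hεm hξ₁m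
  rw [sub_self, zero_div, Real.rpow_zero, mul_one] at hbpart
  have hpow : ∀ ξ : EuclideanSpace ℝ (Fin k), 0 < ε ^ 2 + ‖ξ‖ ^ 2 := fun ξ => by positivity
  have hsq : ∀ ξ : EuclideanSpace ℝ (Fin k),
      b / √(ε ^ 2 + ‖ξ‖ ^ 2) = b * (ε ^ 2 + ‖ξ‖ ^ 2) ^ (-(1 / 2) : ℝ) := fun ξ => by
    rw [Real.rpow_neg (hpow ξ).le, Real.sqrt_eq_rpow, div_eq_mul_inv]
  have hcube : b * ⟪ξ₀, ξ₁ - ξ₀⟫ / (ε ^ 2 + ‖ξ₀‖ ^ 2) ^ ((3 : ℝ) / 2)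
      = -(2 * (-(b / 2) * (ε ^ 2 + ‖ξ₀‖ ^ 2) ^ (-(3 / 2) : ℝ)) * ⟪ξ₀, ξ₁ - ξ₀⟫) := by
    rw [Real.rpow_neg (hpow ξ₀).le, div_eq_mul_inv]; ring
  have hsum :
      (((b / Real.sqrt (ε ^ 2 + ‖ξ₀‖ ^ 2)) • (ξ₁ - ξ₀)
          - (b * ⟪ξ₀, ξ₁ - ξ₀⟫ / (ε ^ 2 + ‖ξ₀‖ ^ 2) ^ ((3 : ℝ) / 2)) • ξ₀
          + g' (ε ^ 2 + ‖ξ₀‖ ^ 2) • (ξ₁ - ξ₀)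
          + (2 * g'' (ε ^ 2 + ‖ξ₀‖ ^ 2) * ⟪ξ₀, ξ₁ - ξ₀⟫) • ξ₀)
        - (((b / Real.sqrt (ε ^ 2 + ‖ξ₁‖ ^ 2)) • ξ₁ + g' (ε ^ 2 + ‖ξ₁‖ ^ 2) • ξ₁)
          - ((b / Real.sqrt (ε ^ 2 + ‖ξ₀‖ ^ 2)) • ξ₀ + g' (ε ^ 2 + ‖ξ₀‖ ^ 2) • ξ₀)))
      = radialRemainder (fun σ => b * σ ^ (-(1 / 2) : ℝ))
          (fun σ => -(b / 2) * σ ^ (-(3 / 2) : ℝ)) ε ξ₀ ξ₁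
        + radialRemainder g' g'' ε ξ₀ ξ₁ := by
    rw [hcube, hsq, hsq, neg_smul]
    unfold radialRemainder
    abel
  rw [hsum]
  have hR : 0 ≤ ‖ξ₁ - ξ₀‖ ^ (1 + β₀) := by positivity
  have hμm : ‖ξ₀‖ ^ (p - 2 - β₀) ≤ c * μ ^ (p - 2 - β₀) :=
    rpow_le_four_rpow_abs_mul hμ0 (by linarith) (by linarith)
  have hδm : ‖ξ₀‖ ^ (1 - 2 - β₀) ≤ δ ^ (1 - p) * ‖ξ₀‖ ^ (p - 2 - β₀) := by
    rw [show 1 - 2 - β₀ = (1 - p) + (p - 2 - β₀) by ring, Real.rpow_add hm]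
    gcongr ?_ * _
    exact Real.rpow_le_rpow_of_nonpos hδ0 (by linarith) (by linarith)
  calc _ ≤ 62 * (168 * b) * ‖ξ₀‖ ^ (1 - 2 - β₀) * ‖ξ₁ - ξ₀‖ ^ (1 + β₀)
        + 62 * Γ * 65 ^ ((p - 1) / 2) * ‖ξ₀‖ ^ (p - 2 - β₀) * ‖ξ₁ - ξ₀‖ ^ (1 + β₀) :=
        (norm_add_le _ _).trans (add_le_add hbpart hgpart)
    _ ≤ 62 * (168 * b) * (δ ^ (1 - p) * ‖ξ₀‖ ^ (p - 2 - β₀)) * ‖ξ₁ - ξ₀‖ ^ (1 + β₀)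
        + 62 * Γ * 65 ^ ((p - 1) / 2) * ‖ξ₀‖ ^ (p - 2 - β₀) * ‖ξ₁ - ξ₀‖ ^ (1 + β₀) := by
        gcongr
    _ = (62 * (168 * b) * δ ^ (1 - p) + 62 * Γ * 65 ^ ((p - 1) / 2)) * ‖ξ₀‖ ^ (p - 2 - β₀)
          * ‖ξ₁ - ξ₀‖ ^ (1 + β₀) := by ring
    _ ≤ (62 * (168 * b) * δ ^ (1 - p) + 62 * Γ * 65 ^ ((p - 1) / 2))
          * (c * μ ^ (p - 2 - β₀)) * ‖ξ₁ - ξ₀‖ ^ (1 + β₀) := by gcongr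
    _ = _ := by ring
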